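/- arXiv:1711.04998 — 2 statements merged into one kernel-verified Lean document; each statement's English description precedes it below -/
import Mathlib

section
/- Let G be a finite non-abelian p-group with a unique non-trivial proper characteristic subgroup N. Then G' = Φ(G) = Z(G) = N, and either G^p = 1 or G^p = N. -/
theorem coatom_aux {p : ℕ} [Fact p.Prime] {G : Type*} [Group G] [Finite G]
    (hp : IsPGroup p G) (M : Subgroup G) (hM : IsCoatom M) :
    commutator G ≤ M ∧ ∀ g : G, g ^ p ∈ M := by
  have hpr : p.Prime := Fact.out
  have hnil : Group.IsNilpotent G := hp.isNilpotent
  have hn : M.Normal :=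
    Subgroup.NormalizerCondition.normal_of_coatom M Group.normalizerCondition_of_isNilpotent hM
  obtain ⟨a, ha⟩ := (hp.to_subgroup M).exists_card_eq
  obtain ⟨b, hb⟩ := hp.index M
  have hci := M.card_mul_index
  have hb0 : b ≠ 0 := by
    rintro rfl
    exact hM.1 (Subgroup.index_eq_one.mp (by simpa using hb))
  have hdvd : p ^ (a + 1) ∣ Nat.card G := by
    rw [← hci, ha, hb, ← pow_add]
    exact pow_dvd_pow p (by omega)
  obtain ⟨K, hK, hMK⟩ := Sylow.exists_subgroup_card_pow_succ hdvd ha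
  have hKtop : K = ⊤ := by
    apply hM.2
    refine lt_of_le_of_ne hMK ?_
    rintro rfl
    rw [ha] at hK
    have := Nat.pow_right_injective hpr.two_le hK
    omega
  subst hKtop
  have hcard : Nat.card (G ⧸ M) = p := by
    rw [← Subgroup.index_eq_card]
    rw [Subgroup.card_top] at hK
    rw [hK, ha, pow_succ] at hci
    exact Nat.eq_of_mul_eq_mul_left (pow_pos hpr.pos a) hci
  have hcyc : IsCyclic (G ⧸ M) := isCyclic_of_prime_card hcard
  refine ⟨Subgroup.Normal.quotient_commutative_iff_commutator_le.mp inferInstance, fun g => ?_⟩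
  rw [← QuotientGroup.eq_one_iff, QuotientGroup.mk_pow, ← hcard]
  exact pow_card_eq_one'

/-- If `G` is a finite non-abelian `p`-group whose only characteristic
subgroups are `⊥`, `N` and `⊤` (with `⊥ < N < ⊤`), then
`G' = Φ(G) = Z(G) = N` and either `G^p = 1` or `G^p = N`. -/
theorem stmt2 {p : ℕ} [Fact p.Prime] {G : Type*} [Group G] [Finite G]
    (hp : IsPGroup p G) (hna : ¬ ∀ x y : G, x * y = y * x)
    (N : Subgroup G) (hchar : N.Characteristic) (hbot : N ≠ ⊥) (htop : N ≠ ⊤)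
    (huniq : ∀ H : Subgroup G, H.Characteristic → H = ⊥ ∨ H = N ∨ H = ⊤) :
    commutator G = N ∧ frattini G = N ∧ Subgroup.center G = N ∧
      (Subgroup.closure {x : G | ∃ g : G, x = g ^ p} = ⊥ ∨
       Subgroup.closure {x : G | ∃ g : G, x = g ^ p} = N) := by
  have hnt : Nontrivial G := by
    by_contra h
    rw [not_nontrivial_iff_subsingleton] at h
    exact hna fun x y => Subsingleton.elim _ _
  have hnc : ¬ IsMulCommutative G := fun h => hna fun x y => h.is_comm.comm x y
  have hc0 : commutator G ≠ ⊥ := fun h => hnc ((commutator_eq_bot_iff G).mp h)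
  have hcf : commutator G ≤ frattini G := le_iInf₂ fun M hM => (coatom_aux hp M hM).1
  have hpf : Subgroup.closure {x : G | ∃ g : G, x = g ^ p} ≤ frattini G := by
    rw [Subgroup.closure_le]
    rintro x ⟨g, rfl⟩
    exact (le_iInf₂ fun M hM => (Subgroup.zpowers_le.mpr ((coatom_aux hp M hM).2 g)) :
      Subgroup.zpowers (g ^ p) ≤ frattini G) (Subgroup.mem_zpowers _)
  have hft : frattini G ≠ ⊤ := fun h =>
    bot_ne_top (frattini_nongenerating (K := (⊥ : Subgroup G)) (by simp [h]))
  have hfN : frattini G = N := by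
    rcases huniq _ frattini_characteristic with h | h | h
    · exact absurd (le_bot_iff.mp (h ▸ hcf)) hc0
    · exact h
    · exact absurd h hft
  have hNt : ¬ (⊤ : Subgroup G) ≤ frattini G := fun h => hft (top_le_iff.mp h)
  have hcN : commutator G = N := by
    rcases huniq (commutator G) (Subgroup.commutator_characteristic _ _) with h | h | h
    · exact absurd h hc0
    · exact h
    · exact absurd (h ▸ hcf) hNt
  have hzN : Subgroup.center G = N := by
    rcases huniq (Subgroup.center G) inferInstance with h | h | h
    · exact absurd h hp.bot_lt_center.ne'
    · exact h
    · exact absurd (Subgroup.center_eq_top_iff.mp h) hnc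
  refine ⟨hcN, hfN, hzN, ?_⟩
  have hch : (Subgroup.closure {x : G | ∃ g : G, x = g ^ p}).Characteristic := by
    rw [Subgroup.characteristic_iff_le_comap]
    intro φ
    rw [Subgroup.closure_le]
    rintro x ⟨g, rfl⟩
    exact Subgroup.subset_closure ⟨φ g, by simp⟩
  rcases huniq _ hch with h | h | h
  · exact Or.inl h
  · exact Or.inr h
  · exact absurd (h ▸ hpf) hNt
end

section
/- Let F be a field with char F = 0 or char F > m + n, let G = GL(2,F) act on homogeneous polynomials by substitution, and let V_k denote the space of homogeneous polynomials of degree k in X, Y. Then V_m ⊗ V_n is isomorphic as an F[G]-module to the direct sum over i = 0, …, min(m,n) of V_det^{⊗i} ⊗ V_{m+n−2i}, where V_det is the 1-dimensional module on which g acts by det(g). -/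
open MvPolynomial TensorProduct DirectSum

/-- The action of a `2×2` matrix on polynomials in `X, Y` by linear substitution:
`X^iY^j ↦ (a₁₁X + a₁₂Y)^i (a₂₁X + a₂₂Y)^j`. -/
noncomputable def polyAct {F : Type*} [Field F] (g : Matrix (Fin 2) (Fin 2) F) :
    MvPolynomial (Fin 2) F →ₐ[F] MvPolynomial (Fin 2) F :=
  aeval (fun i => ∑ j, g i j • X j)

lemma polyAct_mem {F : Type*} [Field F] (g : Matrix (Fin 2) (Fin 2) F) (d : ℕ)
    {p : MvPolynomial (Fin 2) F} (hp : p ∈ homogeneousSubmodule (Fin 2) F d) :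
    polyAct g p ∈ homogeneousSubmodule (Fin 2) F d := by
  rw [mem_homogeneousSubmodule] at hp ⊢
  have h := hp.aeval (S := F) (τ := Fin 2) (fun i => ∑ j, g i j • X j) (n := 1) ?_
  · simpa [polyAct] using h
  · intro i
    apply IsHomogeneous.sum
    intro j _
    rw [smul_eq_C_mul]
    exact (isHomogeneous_X _ _).C_mul _

/-- The restriction of the substitution action to homogeneous polynomials of
degree `d` (the module `V_d`). -/
noncomputable def homAct {F : Type*} [Field F] (g : Matrix (Fin 2) (Fin 2) F) (d : ℕ) :
    homogeneousSubmodule (Fin 2) F d →ₗ[F] homogeneousSubmodule (Fin 2) F d :=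
  LinearMap.codRestrict _
    ((polyAct g).toLinearMap ∘ₗ (homogeneousSubmodule (Fin 2) F d).subtype)
    (fun p => polyAct_mem g d p.2)

namespace CG

variable {F : Type*} [Field F]

/-- Cayley's Omega operator on `P ⊗ P`. -/
noncomputable def Om : (MvPolynomial (Fin 2) F ⊗[F] MvPolynomial (Fin 2) F) →ₗ[F]
    (MvPolynomial (Fin 2) F ⊗[F] MvPolynomial (Fin 2) F) :=
  TensorProduct.map (pderiv 0).toLinearMap (pderiv 1).toLinearMap -
    TensorProduct.map (pderiv 1).toLinearMap (pderiv 0).toLinearMap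

lemma Om_tmul (p q : MvPolynomial (Fin 2) F) :
    Om (p ⊗ₜ[F] q) = pderiv 0 p ⊗ₜ pderiv 1 q - pderiv 1 p ⊗ₜ pderiv 0 q := rfl

/-- The determinant element. -/
noncomputable def De : MvPolynomial (Fin 2) F ⊗[F] MvPolynomial (Fin 2) F :=
  X 0 ⊗ₜ X 1 - X 1 ⊗ₜ X 0

/-- Bihomogeneous elements. -/
noncomputable def S (F : Type*) [Field F] (m n : ℕ) :
    Submodule F (MvPolynomial (Fin 2) F ⊗[F] MvPolynomial (Fin 2) F) :=
  LinearMap.range (TensorProduct.map (homogeneousSubmodule (Fin 2) F m).subtype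
    (homogeneousSubmodule (Fin 2) F n).subtype)

lemma tmul_mem {m n : ℕ} {p q : MvPolynomial (Fin 2) F} (hp : p.IsHomogeneous m)
    (hq : q.IsHomogeneous n) : p ⊗ₜ[F] q ∈ S F m n :=
  ⟨(⟨p, hp⟩ : homogeneousSubmodule (Fin 2) F m) ⊗ₜ (⟨q, hq⟩ : homogeneousSubmodule (Fin 2) F n),
    rfl⟩

lemma S_induction {m n : ℕ} {C : MvPolynomial (Fin 2) F ⊗[F] MvPolynomial (Fin 2) F → Prop}
    (h0 : C 0) (hadd : ∀ x y, C x → C y → C (x + y))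
    (ht : ∀ p q, p.IsHomogeneous m → q.IsHomogeneous n → C (p ⊗ₜ q))
    {t} (h : t ∈ S F m n) : C t := by
  obtain ⟨u, rfl⟩ := h
  induction u with
  | zero => simpa using h0
  | tmul x y => exact ht _ _ x.2 y.2
  | add x y hx hy => rw [map_add]; exact hadd _ _ hx hy

lemma Om_mem {m n : ℕ} {t} (h : t ∈ S F m n) : Om t ∈ S F (m - 1) (n - 1) := by
  refine S_induction (C := fun t => Om t ∈ S F (m - 1) (n - 1)) ?_ ?_ ?_ h
  · simp
  · intro x y hx hy
    rw [map_add]; exact add_mem hx hy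
  · intro p q hp hq
    rw [Om_tmul]
    exact sub_mem (tmul_mem hp.pderiv hq.pderiv) (tmul_mem hp.pderiv hq.pderiv)

lemma Om_pow_mem {m n : ℕ} (k : ℕ) {t} (h : t ∈ S F m n) :
    (Om ^ k) t ∈ S F (m - k) (n - k) := by
  induction k with
  | zero => simpa using h
  | succ k ih =>
    rw [pow_succ', Module.End.mul_apply]
    simpa [Nat.sub_sub] using Om_mem ih

lemma De_mul_mem {m n : ℕ} {t} (h : t ∈ S F m n) : De * t ∈ S F (m + 1) (n + 1) := by
  refine S_induction (C := fun t => De * t ∈ S F (m + 1) (n + 1)) ?_ ?_ ?_ h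
  · simp
  · intro x y hx hy
    rw [mul_add]; exact add_mem hx hy
  · intro p q hp hq
    rw [De, sub_mul, Algebra.TensorProduct.tmul_mul_tmul, Algebra.TensorProduct.tmul_mul_tmul,
      add_comm m, add_comm n]
    exact sub_mem (tmul_mem ((isHomogeneous_X _ _).mul hp) ((isHomogeneous_X _ _).mul hq))
      (tmul_mem ((isHomogeneous_X _ _).mul hp) ((isHomogeneous_X _ _).mul hq))

lemma Om_De {m n : ℕ} {t} (h : t ∈ S F m n) :
    Om (De * t) = De * Om t + ((m : F) + n + 2) • t := by
  refine S_induction (C := fun t => Om (De * t) = De * Om t + ((m : F) + n + 2) • t) ?_ ?_ ?_ h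
  · simp
  · intro x y hx hy
    rw [mul_add, map_add, hx, hy, map_add, mul_add, smul_add]; abel
  · intro p q hp hq
    have ep := hp.sum_X_mul_pderiv
    have eq := hq.sum_X_mul_pderiv
    rw [Fin.sum_univ_two, ← Nat.cast_smul_eq_nsmul F] at ep eq
    have e1 : ((m : F) + n + 2) • (p ⊗ₜ[F] q) =
        ((m : F) • p) ⊗ₜ q + p ⊗ₜ ((n : F) • q) + p ⊗ₜ q + p ⊗ₜ q := by
      rw [TensorProduct.tmul_smul, ← TensorProduct.smul_tmul', add_smul, add_smul, two_smul]
      abel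
    rw [e1, ← ep, ← eq, De, sub_mul]
    simp only [Algebra.TensorProduct.tmul_mul_tmul, map_sub, Om_tmul, pderiv_mul, pderiv_X_self,
      pderiv_X_of_ne (show (1 : Fin 2) ≠ 0 by decide),
      pderiv_X_of_ne (show (0 : Fin 2) ≠ 1 by decide), sub_mul, mul_sub, zero_mul, zero_add,
      one_mul, TensorProduct.add_tmul, TensorProduct.tmul_add]
    abel

lemma Om_pow_De {m n : ℕ} (k : ℕ) (hm : k ≤ m) (hn : k ≤ n) {t} (h : t ∈ S F m n) :
    (Om ^ (k + 1)) (De * t) = De * (Om ^ (k + 1)) t +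
      (((k : F) + 1) * ((m : F) + n + 2 - k)) • (Om ^ k) t := by
  induction k with
  | zero => simpa using Om_De h
  | succ k ih =>
    rw [pow_succ', Module.End.mul_apply, ih (by omega) (by omega), map_add, map_smul,
      Om_De (Om_pow_mem (k + 1) h), ← Module.End.mul_apply, ← pow_succ', ← Module.End.mul_apply,
      ← pow_succ', add_assoc, ← add_smul, Nat.cast_sub hm, Nat.cast_sub hn]
    congr 2
    push_cast
    ring

/-- The transvectant. -/
noncomputable def T (k : ℕ) : (MvPolynomial (Fin 2) F ⊗[F] MvPolynomial (Fin 2) F) →ₗ[F]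
    MvPolynomial (Fin 2) F :=
  (Algebra.TensorProduct.lmul' F).toLinearMap ∘ₗ (Om ^ k)

lemma T_apply (k : ℕ) (t : MvPolynomial (Fin 2) F ⊗[F] MvPolynomial (Fin 2) F) :
    T k t = Algebra.TensorProduct.lmul' F ((Om ^ k) t) := rfl

lemma lmul_De : Algebra.TensorProduct.lmul' F (De : MvPolynomial (Fin 2) F ⊗[F] _) = 0 := by
  simp [De, mul_comm]

lemma T_zero_De (t : MvPolynomial (Fin 2) F ⊗[F] MvPolynomial (Fin 2) F) :
    T 0 (De * t) = 0 := by
  simp [T_apply, lmul_De]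

lemma T_succ_De {m n : ℕ} (k : ℕ) (hm : k ≤ m) (hn : k ≤ n) {t} (h : t ∈ S F m n) :
    T (k + 1) (De * t) = (((k : F) + 1) * ((m : F) + n + 2 - k)) • T k t := by
  rw [T_apply, Om_pow_De k hm hn h, map_add, map_mul, lmul_De, zero_mul, zero_add, map_smul]
  rfl

lemma T_mem {m n : ℕ} (k : ℕ) (hk : k ≤ min m n) {t} (h : t ∈ S F m n) :
    T k t ∈ homogeneousSubmodule (Fin 2) F (m + n - 2 * k) := by
  have e : m + n - 2 * k = (m - k) + (n - k) := by omega
  rw [T_apply, e]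
  refine S_induction (C := fun t => Algebra.TensorProduct.lmul' F t ∈ homogeneousSubmodule _ F _)
    ?_ ?_ ?_ (Om_pow_mem k h)
  · simp
  · intro x y hx hy
    rw [map_add]; exact add_mem hx hy
  · intro p q hp hq
    exact hp.mul hq

lemma T_zero_surj {m n : ℕ} {v : MvPolynomial (Fin 2) F}
    (hv : v ∈ homogeneousSubmodule (Fin 2) F (m + n)) : ∃ t ∈ S F m n, T 0 t = v := by
  rw [← homogeneousSubmodule_one_pow, pow_add, homogeneousSubmodule_one_pow,
    homogeneousSubmodule_one_pow] at hv
  induction hv using Submodule.mul_induction_on' with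
  | mem_mul_mem p hp q hq => exact ⟨p ⊗ₜ q, tmul_mem hp hq, by simp [T_apply]⟩
  | add x _ y _ hx hy =>
    obtain ⟨s, hs, rfl⟩ := hx
    obtain ⟨t, ht, rfl⟩ := hy
    exact ⟨s + t, add_mem hs ht, map_add _ _ _⟩

lemma T_surj (m n : ℕ) (hc : ∀ j : ℕ, 0 < j → j ≤ m + n → (j : F) ≠ 0)
    (v : ℕ → MvPolynomial (Fin 2) F)
    (hv : ∀ k ≤ min m n, v k ∈ homogeneousSubmodule (Fin 2) F (m + n - 2 * k)) :
    ∃ t ∈ S F m n, ∀ k ≤ min m n, T k t = v k := by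
  induction m generalizing n v with
  | zero =>
    obtain ⟨t, ht, h⟩ := T_zero_surj (hv 0 (by omega))
    refine ⟨t, ht, fun k hk => ?_⟩
    obtain rfl : k = 0 := by omega
    exact h
  | succ m ih =>
    obtain ⟨t, ht, h⟩ := T_zero_surj (hv 0 (by omega))
    cases n with
    | zero =>
      refine ⟨t, ht, fun k hk => ?_⟩
      obtain rfl : k = 0 := by omega
      exact h
    | succ n =>
      obtain ⟨s, hs, h'⟩ := ih n (fun j h1 h2 => hc j h1 (by omega))
        (fun k => (((k : F) + 1) * ((m : F) + n + 2 - k))⁻¹ • (v (k + 1) - T (k + 1) t)) (by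
          intro k hk
          have e : m + n - 2 * k = m + 1 + (n + 1) - 2 * (k + 1) := by omega
          rw [e]
          exact Submodule.smul_mem _ _ (sub_mem (hv _ (by omega)) (T_mem _ (by omega) ht)))
      refine ⟨t + De * s, add_mem ht (De_mul_mem hs), fun k hk => ?_⟩
      cases k with
      | zero => rw [map_add, T_zero_De, h, add_zero]
      | succ k =>
        have c1 : ((k : F) + 1) ≠ 0 := by exact_mod_cast hc (k + 1) (by omega) (by omega)
        have c2 : ((m : F) + n + 2 - k) ≠ 0 := by
          have := hc (m + n + 2 - k) (by omega) (by omega)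
          rw [Nat.cast_sub (by omega)] at this
          exact_mod_cast this
        rw [map_add, T_succ_De k (by omega) (by omega) hs, h' k (by omega), smul_smul,
          mul_inv_cancel₀ (mul_ne_zero c1 c2), one_smul]
        abel

lemma pderiv_polyAct (g : Matrix (Fin 2) (Fin 2) F) (j : Fin 2) (p : MvPolynomial (Fin 2) F) :
    pderiv j (polyAct g p) = ∑ i, g i j • polyAct g (pderiv i p) := by
  induction p using MvPolynomial.induction_on with
  | C a => simp [polyAct]
  | add p q hp hq => simp only [map_add, hp, hq, smul_add, Finset.sum_add_distrib]
  | mul_X p i hp =>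
    have e : pderiv j (polyAct g (X i)) = C (g i j) := by
      simp only [polyAct, aeval_X, map_sum, Derivation.map_smul, pderiv_X]
      simp [Pi.single_apply, smul_eq_C_mul]
    rw [map_mul, pderiv_mul, hp, e]
    simp only [pderiv_mul, map_add, map_mul, pderiv_X, Fin.sum_univ_two, smul_eq_C_mul]
    fin_cases i <;> simp <;> ring

lemma Om_act (g : Matrix (Fin 2) (Fin 2) F)
    (t : MvPolynomial (Fin 2) F ⊗[F] MvPolynomial (Fin 2) F) :
    Om (TensorProduct.map (polyAct g).toLinearMap (polyAct g).toLinearMap t) =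
      g.det • TensorProduct.map (polyAct g).toLinearMap (polyAct g).toLinearMap (Om t) := by
  induction t with
  | zero => simp
  | add x y hx hy => simp only [map_add, hx, hy, smul_add]
  | tmul p q =>
    simp only [Om_tmul, map_sub, TensorProduct.map_tmul, AlgHom.toLinearMap_apply, pderiv_polyAct,
      Fin.sum_univ_two, TensorProduct.add_tmul, TensorProduct.tmul_add, Matrix.det_fin_two,
      TensorProduct.tmul_smul, ← TensorProduct.smul_tmul']
    module

lemma T_act (g : Matrix (Fin 2) (Fin 2) F) (k : ℕ)
    (t : MvPolynomial (Fin 2) F ⊗[F] MvPolynomial (Fin 2) F) :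
    T k (TensorProduct.map (polyAct g).toLinearMap (polyAct g).toLinearMap t) =
      g.det ^ k • polyAct g (T k t) := by
  have h1 : ∀ k, (Om ^ k) (TensorProduct.map (polyAct g).toLinearMap (polyAct g).toLinearMap t) =
      g.det ^ k • TensorProduct.map (polyAct g).toLinearMap (polyAct g).toLinearMap
        ((Om ^ k) t) := by
    intro k
    induction k with
    | zero => simp
    | succ k ih =>
      rw [pow_succ', Module.End.mul_apply, ih, map_smul, Om_act, smul_smul, ← pow_succ,
        Module.End.mul_apply]
  rw [T_apply, h1, map_smul, T_apply]
  congr 1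
  generalize (Om ^ k) t = u
  induction u with
  | zero => simp
  | add x y hx hy => simp only [map_add, hx, hy]
  | tmul p q => simp

lemma finrank_hom (d : ℕ) : Module.finrank F (homogeneousSubmodule (Fin 2) F d) = d + 1 := by
  rw [homogeneousSubmodule_eq_finsupp_supported]
  have e : {x : Fin 2 →₀ ℕ | x.degree = d} ≃ ↥(Finset.HasAntidiagonal.antidiagonal d) :=
    { toFun := fun x => ⟨(x.1 0, x.1 1), by
        have := x.2
        simpa [Finsupp.degree_eq_sum] using this⟩
      invFun := fun y => ⟨Finsupp.equivFunOnFinite.symm ![y.1.1, y.1.2], by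
        have := Finset.HasAntidiagonal.mem_antidiagonal.mp y.2
        simpa [Finsupp.degree_eq_sum] using this⟩
      left_inv := by
        intro x
        ext i
        fin_cases i <;> simp
      right_inv := by
        intro y
        ext <;> simp }
  have : Fintype {x : Fin 2 →₀ ℕ | x.degree = d} := Fintype.ofEquiv _ e.symm
  rw [(AddMonoidAlgebra.supportedEquivFinsupp _).finrank_eq, Module.finrank_finsupp_self,
    Fintype.card_congr e]
  simp

instance (d : ℕ) : FiniteDimensional F (homogeneousSubmodule (Fin 2) F d) :=
  Module.Finite.iff_fg.mpr (homogeneousSubmodule_fg _ _ _)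

lemma dim_sum (m n s : ℕ) (hs : s ≤ min m n) :
    ∑ i : Fin (s + 1), (m + n - 2 * (i : ℕ) + 1) = (s + 1) * (m + n - s + 1) := by
  rw [Fin.sum_univ_eq_sum_range (fun i => m + n - 2 * i + 1)]
  induction s with
  | zero => simp
  | succ s ih =>
    rw [Finset.sum_range_succ, ih (by omega)]
    obtain ⟨c, hc⟩ : ∃ c, m + n = c + 2 * (s + 1) := ⟨m + n - 2 * (s + 1), by omega⟩
    have e1 : m + n - s = c + s + 2 := by omega
    have e2 : m + n - (s + 1) = c + s + 1 := by omega
    have e3 : m + n - 2 * (s + 1) = c := by omega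
    rw [e1, e2, e3]
    ring

/-- The Clebsch-Gordan map. -/
noncomputable def Phi (F : Type*) [Field F] (m n : ℕ) :
    (homogeneousSubmodule (Fin 2) F m ⊗[F] homogeneousSubmodule (Fin 2) F n) →ₗ[F]
      ⨁ i : Fin (min m n + 1), homogeneousSubmodule (Fin 2) F (m + n - 2 * (i : ℕ)) :=
  (DirectSum.linearEquivFunOnFintype F _ _).symm.toLinearMap ∘ₗ
    LinearMap.pi (fun i : Fin (min m n + 1) => LinearMap.codRestrict
      (homogeneousSubmodule (Fin 2) F (m + n - 2 * (i : ℕ)))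
      (T (i : ℕ) ∘ₗ TensorProduct.map (homogeneousSubmodule (Fin 2) F m).subtype
        (homogeneousSubmodule (Fin 2) F n).subtype)
      (fun u => T_mem _ (by omega) ⟨u, rfl⟩))

lemma Phi_apply (m n : ℕ) (u) (i : Fin (min m n + 1)) :
    ((Phi F m n u i : homogeneousSubmodule (Fin 2) F (m + n - 2 * (i : ℕ))) :
      MvPolynomial (Fin 2) F) =
      T (i : ℕ) (TensorProduct.map (homogeneousSubmodule (Fin 2) F m).subtype
        (homogeneousSubmodule (Fin 2) F n).subtype u) := rfl

lemma inj_of_surj {V W : Type*} [AddCommMonoid V] [Module F V] [AddCommMonoid W] [Module F W]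
    [Module.Free F V] [Module.Finite F V] [Module.Free F W] [Module.Finite F W]
    (f : V →ₗ[F] W) (h : Module.finrank F V = Module.finrank F W)
    (hf : Function.Surjective f) : Function.Injective f := by
  let E : W ≃ₗ[F] V := LinearEquiv.ofFinrankEq W V h.symm
  have h1 : Function.Surjective (E.toLinearMap ∘ₗ f) := E.surjective.comp hf
  have h2 := OrzechProperty.injective_of_surjective_endomorphism _ h1
  exact Function.Injective.of_comp h2

end CG

open CG in
/-- Clebsch–Gordan: For a field `F` with `char F = 0` or
`char F > m + n`, there is a `GL(2,F)`-equivariant isomorphism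
`V_m ⊗ V_n ≅ ⨁_{i=0}^{min(m,n)} V_det^{⊗i} ⊗ V_{m+n−2i}`, where the `i`-th
summand carries the action of `g` twisted by `det(g)^i`. -/
theorem stmt18 {F : Type*} [Field F] (m n : ℕ)
    (hchar : ringChar F = 0 ∨ m + n < ringChar F) :
    ∃ e : (homogeneousSubmodule (Fin 2) F m ⊗[F] homogeneousSubmodule (Fin 2) F n) ≃ₗ[F]
        ⨁ i : Fin (min m n + 1), homogeneousSubmodule (Fin 2) F (m + n - 2 * (i : ℕ)),
      ∀ g : GL (Fin 2) F,
        e.toLinearMap ∘ₗ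
            TensorProduct.map (homAct (g : Matrix (Fin 2) (Fin 2) F) m)
              (homAct (g : Matrix (Fin 2) (Fin 2) F) n) =
          (DFinsupp.mapRange.linearMap (fun i : Fin (min m n + 1) =>
              ((g : Matrix (Fin 2) (Fin 2) F).det ^ (i : ℕ)) •
                homAct (g : Matrix (Fin 2) (Fin 2) F) (m + n - 2 * (i : ℕ)))) ∘ₗ
            e.toLinearMap := by
  have hc : ∀ j : ℕ, 0 < j → j ≤ m + n → (j : F) ≠ 0 := by
    intro j h1 h2 h3
    have h4 := (ringChar.spec F j).mp h3
    rcases hchar with h | h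
    · rw [h, zero_dvd_iff] at h4; omega
    · have := Nat.le_of_dvd h1 h4; omega
  have hsurj : Function.Surjective (Phi F m n) := by
    intro w
    obtain ⟨t, ⟨u, rfl⟩, ht⟩ := T_surj m n hc
      (fun k => if h : k < min m n + 1 then ((w ⟨k, h⟩ : homogeneousSubmodule (Fin 2) F _) :
        MvPolynomial (Fin 2) F) else 0) (by
        intro k hk
        rw [dif_pos (by omega)]
        exact (w ⟨k, by omega⟩).2)
    refine ⟨u, ?_⟩
    refine DFinsupp.ext fun i => Subtype.ext ?_
    have := ht i (by omega)
    rw [dif_pos i.2] at this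
    exact this
  have hdim : Module.finrank F
      (homogeneousSubmodule (Fin 2) F m ⊗[F] homogeneousSubmodule (Fin 2) F n) =
      Module.finrank F
        (⨁ i : Fin (min m n + 1), homogeneousSubmodule (Fin 2) F (m + n - 2 * (i : ℕ))) := by
    rw [Module.finrank_tensorProduct, Module.finrank_directSum]
    simp only [finrank_hom]
    rw [dim_sum m n _ le_rfl]
    rcases le_total m n with h | h
    · rw [min_eq_left h, Nat.add_sub_cancel_left]
    · rw [min_eq_right h, Nat.add_sub_cancel, mul_comm]
  have hinj : Function.Injective (Phi F m n) :=
inj_of_surj _ hdim hsurj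
  refine ⟨LinearEquiv.ofBijective (Phi F m n) ⟨hinj, hsurj⟩, fun g => ?_⟩
  refine LinearMap.ext fun u => DFinsupp.ext fun i => Subtype.ext ?_
  have key : TensorProduct.map (homogeneousSubmodule (Fin 2) F m).subtype
        (homogeneousSubmodule (Fin 2) F n).subtype
        (TensorProduct.map (homAct (g : Matrix (Fin 2) (Fin 2) F) m)
              (homAct (g : Matrix (Fin 2) (Fin 2) F) n) u) =
      TensorProduct.map (polyAct (g : Matrix (Fin 2) (Fin 2) F)).toLinearMap
        (polyAct (g : Matrix (Fin 2) (Fin 2) F)).toLinearMap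
        (TensorProduct.map (homogeneousSubmodule (Fin 2) F m).subtype
        (homogeneousSubmodule (Fin 2) F n).subtype u) := by
    rw [← LinearMap.comp_apply, ← LinearMap.comp_apply, ← TensorProduct.map_comp,
      ← TensorProduct.map_comp]
    rfl
  have h2 := T_act (g : Matrix (Fin 2) (Fin 2) F) i
    (TensorProduct.map (homogeneousSubmodule (Fin 2) F m).subtype
        (homogeneousSubmodule (Fin 2) F n).subtype u)
  rw [← key] at h2
  exact h2
end
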